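/- arXiv:1407.0676 — 2 statements merged into one kernel-verified Lean document; each statement's English description precedes it below -/
import Mathlib

section
/- Let F be a totally bounded subset of a metric space X. If F is equi-homogeneous, attains both its upper and its lower box-counting dimensions, and dim_LB F = dim_B F, then dim_A F = dim_B F = dim_LB F. -/
open Metric Set Filter
open scoped ENNReal NNReal

namespace Paper

noncomputable def coverNum {X : Type*} [MetricSpace X] (F : Set X) (r : ℝ) : ℝ≥0∞ :=
  ⨅ (s : Finset X) (_ : F ⊆ ⋃ x ∈ s, closedBall x r), (s.card : ℝ≥0∞)

noncomputable def diamCoverNum {X : Type*} [MetricSpace X] (F : Set X) (r : ℝ) : ℝ≥0∞ :=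
  ⨅ (U : Finset (Set X)) (_ : F ⊆ ⋃₀ ↑U)
    (_ : ∀ A ∈ U, EMetric.diam A ≤ ENNReal.ofReal r), (U.card : ℝ≥0∞)

noncomputable def lowerBoxDim {X : Type*} [MetricSpace X] (F : Set X) : ℝ :=
  Filter.liminf (fun r : ℝ => Real.log (coverNum F r).toReal / (-Real.log r))
    (nhdsWithin 0 (Set.Ioi 0))

noncomputable def upperBoxDim {X : Type*} [MetricSpace X] (F : Set X) : ℝ :=
  Filter.limsup (fun r : ℝ => Real.log (coverNum F r).toReal / (-Real.log r))
    (nhdsWithin 0 (Set.Ioi 0))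

def IsHomogeneous {X : Type*} [MetricSpace X] (F : Set X) (s : ℝ) : Prop :=
  ∀ δ₀ : ℝ, 0 < δ₀ → ∃ C : ℝ, 0 < C ∧
    ∀ x ∈ F, ∀ δ ρ : ℝ, 0 < ρ → ρ < δ → δ ≤ δ₀ →
      coverNum (closedBall x δ ∩ F) ρ ≤ ENNReal.ofReal (C * (δ / ρ) ^ s)

noncomputable def assouadDim {X : Type*} [MetricSpace X] (F : Set X) : EReal :=
  sInf ((fun s : ℝ => (s : EReal)) '' {s : ℝ | 0 ≤ s ∧ IsHomogeneous F s})

def EquiHomogeneous {X : Type*} [MetricSpace X] (F : Set X) : Prop :=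
  ∀ δ₀ : ℝ, 0 < δ₀ → ∃ M : ℝ≥0, 1 ≤ M ∧ ∃ c₁ c₂ : ℝ, 0 < c₁ ∧ 0 < c₂ ∧
    ∀ δ ρ : ℝ, 0 < ρ → ρ < δ → δ ≤ δ₀ →
      (⨆ x ∈ F, coverNum (closedBall x δ ∩ F) ρ) ≤
        (M : ℝ≥0∞) * ⨅ x ∈ F, coverNum (closedBall x (c₁ * δ) ∩ F) (c₂ * ρ)

noncomputable def cantorLen (lam : ℕ → ℝ) (n : ℕ) : ℝ := ∏ i ∈ Finset.range n, lam i

noncomputable def cantorPre (lam : ℕ → ℝ) (n : ℕ) : Set ℝ :=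
  ⋃ ε : ℕ → Bool,
    Set.Icc (∑ i ∈ Finset.range n, if ε i then cantorLen lam i - cantorLen lam (i + 1) else 0)
      ((∑ i ∈ Finset.range n, if ε i then cantorLen lam i - cantorLen lam (i + 1) else 0) +
        cantorLen lam n)

noncomputable def cantorSet (lam : ℕ → ℝ) : Set ℝ := ⋂ n : ℕ, cantorPre lam n

open Classical in
noncomputable def lamSeq (q : ℝ) (a : ℕ → ℕ) (i : ℕ) : ℝ :=
  if h : ∃ k : ℕ, i + 1 = ∑ j ∈ Finset.range (k + 1), a (2 * j) then
    q ^ (a (2 * h.choose + 1) + 1)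
  else q

open Classical in
noncomputable def muSeq (q : ℝ) (a : ℕ → ℕ) (i : ℕ) : ℝ :=
  if h : ∃ k : ℕ, i + 1 = a 0 + ∑ j ∈ Finset.range (k + 1), a (2 * j + 1) then
    q ^ (a (2 * h.choose + 2) + 1)
  else q

noncomputable def prodSetL2 (C D : Set ℝ) : Set (WithLp 2 (ℝ × ℝ)) :=
  (WithLp.equiv 2 (ℝ × ℝ)).symm '' (C ×ˢ D)

theorem coverNum_le_card {X : Type*} [MetricSpace X] {F : Set X} {r : ℝ} {s : Finset X}
    (h : F ⊆ ⋃ x ∈ s, closedBall x r) : coverNum F r ≤ s.card :=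
  iInf₂_le s h

theorem exists_cover_of_coverNum_ne_top {X : Type*} [MetricSpace X] {F : Set X} {r : ℝ}
    (h : coverNum F r ≠ ⊤) : ∃ s : Finset X, F ⊆ ⋃ x ∈ s, closedBall x r := by
  by_contra! hn
  exact h (iInf₂_eq_top.2 fun s hs => absurd hs (hn s))

theorem one_le_coverNum {X : Type*} [MetricSpace X] {F : Set X} {r : ℝ} (h : F.Nonempty) :
    1 ≤ coverNum F r := by
  refine le_iInf₂ fun s hs => ?_
  obtain ⟨x, hx⟩ := h
  obtain ⟨y, hy, -⟩ := mem_iUnion₂.1 (hs hx)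
  exact_mod_cast Finset.card_pos.2 ⟨y, hy⟩

theorem coverNum_le_sum {X : Type*} [MetricSpace X] {F : Set X} {r : ℝ} (s : Finset X)
    (G : X → Set X) (h : F ⊆ ⋃ x ∈ s, G x) : coverNum F r ≤ ∑ x ∈ s, coverNum (G x) r := by
  classical
  by_cases hfin : ∀ x ∈ s, coverNum (G x) r ≠ ⊤
  · have hex : ∀ x ∈ s, ∃ u : Finset X, G x ⊆ ⋃ y ∈ u, closedBall y r ∧
        (u.card : ℝ≥0∞) = coverNum (G x) r := by
      intro x hx
      obtain ⟨u₀, hu₀⟩ := exists_cover_of_coverNum_ne_top (hfin x hx)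
      let P : ℕ → Prop := fun n => ∃ u : Finset X, u.card = n ∧ G x ⊆ ⋃ y ∈ u, closedBall y r
      have hP : ∃ n, P n := ⟨_, u₀, rfl, hu₀⟩
      obtain ⟨u, hu, hcov⟩ := Nat.find_spec hP
      refine ⟨u, hcov, le_antisymm ?_ (coverNum_le_card hcov)⟩
      refine le_iInf₂ fun v hv => ?_
      rw [hu]
      exact_mod_cast Nat.find_min' hP ⟨v, rfl, hv⟩
    choose! u hcov hcard using hex
    have hF : F ⊆ ⋃ y ∈ s.biUnion u, closedBall y r := by
      intro z hz
      obtain ⟨x, hx, hzx⟩ := mem_iUnion₂.1 (h hz)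
      obtain ⟨y, hy, hzy⟩ := mem_iUnion₂.1 (hcov x hx hzx)
      exact mem_iUnion₂.2 ⟨y, Finset.mem_biUnion.2 ⟨x, hx, hy⟩, hzy⟩
    calc coverNum F r ≤ ((s.biUnion u).card : ℝ≥0∞) := coverNum_le_card hF
      _ ≤ ∑ x ∈ s, ((u x).card : ℝ≥0∞) := by exact_mod_cast Finset.card_biUnion_le
      _ = _ := Finset.sum_congr rfl hcard
  · push Not at hfin
    rw [ENNReal.sum_eq_top.2 hfin]
    exact le_top

theorem card_mul_le_coverNum {X : Type*} [MetricSpace X] {F : Set X} {a r : ℝ} {t : Finset X}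
    (hsep : ∀ x ∈ t, ∀ y ∈ t, x ≠ y → 2 * (a + r) < dist x y) {m : ℝ≥0∞}
    (hm : ∀ y ∈ t, m ≤ coverNum (closedBall y a ∩ F) r) :
    (t.card : ℝ≥0∞) * m ≤ coverNum F r := by
  classical
  refine le_iInf₂ fun s hs => ?_
  let u : X → Finset X := fun y => s.filter fun z => (closedBall z r ∩ closedBall y a).Nonempty
  have hdisj : (t : Set X).PairwiseDisjoint u := by
    intro x hx y hy hxy
    refine Finset.disjoint_left.2 fun z hzx hzy => ?_
    obtain ⟨p, hpz, hpx⟩ := (Finset.mem_filter.1 hzx).2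
    obtain ⟨q, hqz, hqy⟩ := (Finset.mem_filter.1 hzy).2
    rw [mem_closedBall] at hpz hpx hqz hqy
    have h₁ := hsep x hx y hy hxy
    have h₂ := dist_triangle4 x p q y
    have h₃ := dist_triangle_right p q z
    rw [dist_comm x p] at h₂
    linarith
  have hcov : ∀ y ∈ t, m ≤ (u y).card := by
    refine fun y hy => (hm y hy).trans (coverNum_le_card fun p hp => ?_)
    obtain ⟨z, hz, hpz⟩ := mem_iUnion₂.1 (hs hp.2)
    exact mem_iUnion₂.2 ⟨z, Finset.mem_filter.2 ⟨hz, p, hpz, hp.1⟩, hpz⟩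
  calc (t.card : ℝ≥0∞) * m = ∑ _y ∈ t, m := by rw [Finset.sum_const, nsmul_eq_mul]
    _ ≤ ∑ y ∈ t, ((u y).card : ℝ≥0∞) := Finset.sum_le_sum hcov
    _ = ((t.biUnion u).card : ℝ≥0∞) := by rw [Finset.card_biUnion hdisj]; push_cast; rfl
    _ ≤ s.card := by
      exact_mod_cast Finset.card_le_card
        (Finset.biUnion_subset.2 fun y _ => Finset.filter_subset _ _)

theorem exists_separated_cover {X : Type*} [MetricSpace X] {F : Set X} {R : ℝ} (hR : 0 < R)
    (hF : coverNum F (R / 2) ≠ ⊤) : ∃ t : Finset X, ↑t ⊆ F ∧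
      (∀ x ∈ t, ∀ y ∈ t, x ≠ y → R < dist x y) ∧ F ⊆ ⋃ x ∈ t, closedBall x R := by
  classical
  let P : ℕ → Prop := fun n => ∃ t : Finset X, t.card = n ∧ ↑t ⊆ F ∧
    ∀ x ∈ t, ∀ y ∈ t, x ≠ y → R < dist x y
  obtain ⟨s, hs⟩ := exists_cover_of_coverNum_ne_top hF
  have hbound : ∀ n, P n → n ≤ s.card := by
    rintro n ⟨t, rfl, htF, hsep⟩
    have h := card_mul_le_coverNum (F := F) (a := 0) (r := R / 2) (t := t) (m := 1)
      (by intro x hx y hy hxy; linarith [hsep x hx y hy hxy])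
      (fun y hy => one_le_coverNum ⟨y, mem_closedBall_self le_rfl, htF hy⟩)
    rw [mul_one] at h
    exact_mod_cast h.trans (coverNum_le_card hs)
  have hP₀ : P 0 := ⟨∅, rfl, by simp, by simp⟩
  obtain ⟨t, ht, htF, hsep⟩ := Nat.findGreatest_spec (P := P) (Nat.zero_le s.card) hP₀
  refine ⟨t, htF, hsep, fun z hz => ?_⟩
  by_contra hn
  simp only [mem_iUnion, mem_closedBall, not_exists, not_le] at hn
  have hzt : z ∉ t := fun h => by
    have := hn z h
    rw [dist_self] at this
    linarith
  have hP : P (t.card + 1) := by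
    refine ⟨insert z t, Finset.card_insert_of_notMem hzt, ?_, ?_⟩
    · rw [Finset.coe_insert]
      exact insert_subset hz htF
    · intro x hx y hy hxy
      rcases Finset.mem_insert.1 hx with rfl | hxt <;>
        rcases Finset.mem_insert.1 hy with rfl | hyt
      · exact absurd rfl hxy
      · exact hn y hyt
      · rw [dist_comm]
        exact hn x hxt
      · exact hsep x hxt y hyt hxy
  have := Nat.le_findGreatest (hbound _ hP) hP
  omega

theorem nonpos_of_forall_le_mul_rpow {c K e : ℝ} (hc : 0 < c)
    (h : ∀ r : ℝ, 0 < r → r < 1 → c ≤ K * r ^ e) : e ≤ 0 := by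
  by_contra! he
  have hlim : Tendsto (fun r : ℝ => K * r ^ e) (nhdsWithin 0 (Ioi 0)) (nhds (K * 0 ^ e)) :=
    ((Real.continuousAt_rpow_const 0 e (Or.inr he.le)).tendsto.mono_left
      nhdsWithin_le_nhds).const_mul K
  rw [Real.zero_rpow he.ne', mul_zero] at hlim
  refine hc.not_ge (ge_of_tendsto hlim ?_)
  filter_upwards [Ioo_mem_nhdsGT (zero_lt_one' ℝ)] with r hr using h r hr.1 hr.2

theorem isHomogeneous_of_attains {X : Type*} [MetricSpace X] {F : Set X} {d : ℝ}
    (hTB : ∀ r : ℝ, 0 < r → coverNum F r ≠ ⊤) (hEH : EquiHomogeneous F)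
    (hLower : ∀ δ₀ : ℝ, 0 < δ₀ → ∃ C : ℝ, 0 < C ∧ C ≤ 1 ∧
      ∀ δ : ℝ, 0 < δ → δ ≤ δ₀ → ENNReal.ofReal (C * δ ^ (-d)) ≤ coverNum F δ)
    (hUpper : ∀ δ₀ : ℝ, 0 < δ₀ → ∃ C : ℝ, 1 ≤ C ∧
      ∀ δ : ℝ, 0 < δ → δ ≤ δ₀ → coverNum F δ ≤ ENNReal.ofReal (C * δ ^ (-d))) :
    IsHomogeneous F d := by
  intro δ₀ hδ₀
  obtain ⟨M, hM, c₁, c₂, hc₁, hc₂, hE⟩ := hEH δ₀ hδ₀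
  obtain ⟨A, hA, -, hlow⟩ := hLower (2 * (c₁ + c₂) * δ₀) (by positivity)
  obtain ⟨B, hB, hupp⟩ := hUpper (c₂ * δ₀) (by positivity)
  have hB₀ : 0 < B := by linarith
  have hM₀ : (0 : ℝ) < M := lt_of_lt_of_le one_pos (by exact_mod_cast hM)
  refine ⟨M * (B / A * (2 * (c₁ + c₂) / c₂) ^ d), by positivity, ?_⟩
  intro x hx δ ρ hρ hρδ hδ
  have hδ' : 0 < δ := hρ.trans hρδ
  set m : ℝ≥0∞ := ⨅ y ∈ F, coverNum (closedBall y (c₁ * δ) ∩ F) (c₂ * ρ) with hm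
  set R : ℝ := 2 * (c₁ + c₂) * δ with hRdef
  have hR : 0 < R := by positivity
  obtain ⟨t, htF, hsep, hcov⟩ := exists_separated_cover hR (hTB (R / 2) (by positivity))
  have hcard : ENNReal.ofReal (A * R ^ (-d)) ≤ t.card :=
    (hlow R hR (by rw [hRdef]; gcongr)).trans (coverNum_le_card hcov)
  have hprod : (t.card : ℝ≥0∞) * m ≤ coverNum F (c₂ * ρ) := by
    refine card_mul_le_coverNum (a := c₁ * δ) (fun x hx y hy hxy => ?_)
      fun y hy => iInf₂_le y (htF hy)
    refine lt_of_le_of_lt ?_ (hsep x hx y hy hxy)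
    have := mul_le_mul_of_nonneg_left hρδ.le hc₂.le
    rw [hRdef]
    linarith
  have hpos : 0 < A * R ^ (-d) := by positivity
  have hmle : m ≤ ENNReal.ofReal (B * (c₂ * ρ) ^ (-d) / (A * R ^ (-d))) := by
    rw [ENNReal.ofReal_div_of_pos hpos,
      ENNReal.le_div_iff_mul_le (Or.inl (ENNReal.ofReal_pos.2 hpos).ne')
        (Or.inl ENNReal.ofReal_ne_top), mul_comm]
    calc _ ≤ (t.card : ℝ≥0∞) * m := by gcongr
      _ ≤ _ := hprod.trans (hupp _ (by positivity) (by gcongr; linarith))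
  have hratio : B * (c₂ * ρ) ^ (-d) / (A * R ^ (-d)) =
      B / A * (2 * (c₁ + c₂) / c₂) ^ d * (δ / ρ) ^ d := by
    rw [mul_assoc, ← Real.mul_rpow (by positivity) (by positivity), mul_div_mul_comm,
      ← Real.div_rpow (by positivity) hR.le, Real.rpow_neg (by positivity),
      ← Real.inv_rpow (by positivity), inv_div, hRdef, mul_div_mul_comm]
  calc coverNum (closedBall x δ ∩ F) ρ
      ≤ ⨆ y ∈ F, coverNum (closedBall y δ ∩ F) ρ :=
        le_iSup₂ (f := fun y (_ : y ∈ F) => coverNum (closedBall y δ ∩ F) ρ) x hx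
    _ ≤ M * m := hE δ ρ hρ hρδ hδ
    _ ≤ ENNReal.ofReal M * ENNReal.ofReal (B * (c₂ * ρ) ^ (-d) / (A * R ^ (-d))) := by
        rw [ENNReal.ofReal_coe_nnreal]
        gcongr
    _ = _ := by rw [← ENNReal.ofReal_mul hM₀.le, hratio]; congr 1; ring

theorem le_of_isHomogeneous {X : Type*} [MetricSpace X] {F : Set X} {d s C : ℝ}
    (hTB : ∀ r : ℝ, 0 < r → coverNum F r ≠ ⊤) (hC : 0 < C)
    (hLower : ∀ δ : ℝ, 0 < δ → δ ≤ 1 → ENNReal.ofReal (C * δ ^ (-d)) ≤ coverNum F δ)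
    (hs : IsHomogeneous F s) : d ≤ s := by
  obtain ⟨D, hD, hhom⟩ := hs 1 one_pos
  obtain ⟨t, htF, -, hcov⟩ := exists_separated_cover one_pos (hTB (1 / 2) (by norm_num))
  refine sub_nonpos.1 (nonpos_of_forall_le_mul_rpow (K := t.card * D) hC fun r hr hr1 => ?_)
  have hsum : coverNum F r ≤ ∑ x ∈ t, coverNum (closedBall x 1 ∩ F) r :=
    coverNum_le_sum t _ fun z hz => by
      obtain ⟨x, hx, hzx⟩ := mem_iUnion₂.1 (hcov hz)
      exact mem_iUnion₂.2 ⟨x, hx, hzx, hz⟩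
  have hle : ENNReal.ofReal (C * r ^ (-d)) ≤ ENNReal.ofReal (t.card * (D * (1 / r) ^ s)) :=
    calc _ ≤ ∑ x ∈ t, coverNum (closedBall x 1 ∩ F) r := (hLower r hr hr1.le).trans hsum
      _ ≤ ∑ _x ∈ t, ENNReal.ofReal (D * (1 / r) ^ s) :=
        Finset.sum_le_sum fun x hx => hhom x (htF hx) 1 r hr hr1 le_rfl
      _ = _ := by
        rw [Finset.sum_const, nsmul_eq_mul, ENNReal.ofReal_mul (Nat.cast_nonneg _),
          ENNReal.ofReal_natCast]
  have hreal := (ENNReal.ofReal_le_ofReal_iff (by positivity)).1 hle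
  rw [one_div, Real.inv_rpow hr.le, Real.rpow_neg hr.le] at hreal
  have hd : 0 < r ^ d := by positivity
  have hmul := mul_le_mul_of_nonneg_right hreal hd.le
  rw [Real.rpow_sub hr]
  calc C = C * (r ^ d)⁻¹ * r ^ d := by field_simp
    _ ≤ _ := hmul
    _ = _ := by ring

theorem statement6 {X : Type*} [MetricSpace X] (F : Set X)
    (hTB : ∀ r : ℝ, 0 < r → coverNum F r ≠ ⊤)
    (hEH : EquiHomogeneous F)
    (hAttainsLower : ∀ δ₀ : ℝ, 0 < δ₀ → ∃ C : ℝ, 0 < C ∧ C ≤ 1 ∧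
      ∀ δ : ℝ, 0 < δ → δ ≤ δ₀ →
        ENNReal.ofReal (C * δ ^ (-(lowerBoxDim F))) ≤ coverNum F δ)
    (hAttainsUpper : ∀ δ₀ : ℝ, 0 < δ₀ → ∃ C : ℝ, 1 ≤ C ∧
      ∀ δ : ℝ, 0 < δ → δ ≤ δ₀ →
        coverNum F δ ≤ ENNReal.ofReal (C * δ ^ (-(upperBoxDim F))))
    (hEq : lowerBoxDim F = upperBoxDim F) :
    assouadDim F = ((upperBoxDim F : ℝ) : EReal) ∧ upperBoxDim F = lowerBoxDim F := by
  rw [hEq] at hAttainsLower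
  set d := upperBoxDim F
  obtain ⟨A, hA, -, hlow⟩ := hAttainsLower 1 one_pos
  obtain ⟨B, -, hupp⟩ := hAttainsUpper 1 one_pos
  have hne : F.Nonempty := by
    by_contra hF
    rw [not_nonempty_iff_eq_empty] at hF
    have h := (hlow 1 one_pos le_rfl).trans
      (coverNum_le_card (s := ∅) (by rw [hF]; exact empty_subset _))
    rw [Real.one_rpow, mul_one, Finset.card_empty, Nat.cast_zero, nonpos_iff_eq_zero,
      ENNReal.ofReal_eq_zero] at h
    exact h.not_gt hA
  have hd : 0 ≤ d := by
    refine neg_nonpos.1 (nonpos_of_forall_le_mul_rpow (K := B) one_pos fun r hr hr1 => ?_)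
    exact ENNReal.one_le_ofReal.1 ((one_le_coverNum hne).trans (hupp r hr hr1.le))
  refine ⟨le_antisymm (sInf_le ⟨d, ⟨hd, ?_⟩, rfl⟩) (le_sInf ?_), hEq.symm⟩
  · exact isHomogeneous_of_attains hTB hEH hAttainsLower hAttainsUpper
  · rintro _ ⟨s, ⟨-, hs⟩, rfl⟩
    exact EReal.coe_le_coe_iff.2 (le_of_isHomogeneous hTB hA hlow hs)

end Paper
end

section
/- Every generalised Cantor set C generated by a sequence (λ_i) with λ_i ∈ (0,1/2) is equi-homogeneous; in fact, for all δ, ρ with 0 < ρ < δ one has sup_{x∈C} D(B_δ(x) ∩ C, ρ) ≤ 6 inf_{x∈C} D(B_δ(x) ∩ C, ρ), where D(F,r) is the minimum number of sets of diameter at most r needed to cover F. -/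
open Metric Set Filter
open scoped ENNReal NNReal

namespace Paper

section Covers

variable {X : Type*} [MetricSpace X]

theorem diamCoverNum_le_card {F : Set X} {r : ℝ} (U : Finset (Set X)) (hU : F ⊆ ⋃₀ ↑U)
    (hd : ∀ A ∈ U, ediam A ≤ ENNReal.ofReal r) : diamCoverNum F r ≤ U.card :=
  iInf_le_of_le U (iInf_le_of_le hU (iInf_le _ hd))

theorem diamCoverNum_mono {F G : Set X} (h : F ⊆ G) (r : ℝ) :
    diamCoverNum F r ≤ diamCoverNum G r :=
  le_iInf fun U => le_iInf fun hU => le_iInf fun hd => diamCoverNum_le_card U (h.trans hU) hd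

theorem diamCoverNum_union_le (F G : Set X) (r : ℝ) :
    diamCoverNum (F ∪ G) r ≤ diamCoverNum F r + diamCoverNum G r := by
  classical
  conv_rhs => unfold diamCoverNum
  simp only [ENNReal.iInf_add, ENNReal.add_iInf]
  refine le_iInf fun U => le_iInf fun hU => le_iInf fun hUd =>
    le_iInf fun V => le_iInf fun hV => le_iInf fun hVd => ?_
  refine (diamCoverNum_le_card (V ∪ U) ?_ ?_).trans ?_
  · rw [Finset.coe_union, sUnion_union]
    exact union_subset_union hV hU
  · intro A hA
    exact (Finset.mem_union.1 hA).elim (hVd A) (hUd A)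
  · exact_mod_cast Finset.card_union_le V U

theorem _root_.Isometry.diamCoverNum_image_le {Y : Type*} [MetricSpace Y] {f : X → Y}
    (hf : Isometry f) (F : Set X) (r : ℝ) :
    diamCoverNum (f '' F) r ≤ diamCoverNum F r := by
  classical
  refine le_iInf fun U => le_iInf fun hU => le_iInf fun hd => ?_
  refine (diamCoverNum_le_card (U.image (f '' ·)) ?_ ?_).trans
    (by exact_mod_cast Finset.card_image_le)
  · rintro _ ⟨x, hx, rfl⟩
    obtain ⟨A, hA, hxA⟩ := hU hx
    exact ⟨f '' A, by simpa using ⟨A, hA, rfl⟩, mem_image_of_mem f hxA⟩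
  · intro B hB
    obtain ⟨A, hA, rfl⟩ := Finset.mem_image.1 hB
    exact (hf.ediam_image A).trans_le (hd A hA)

theorem coverNum_le_diamCoverNum [Nonempty X] (F : Set X) {r : ℝ} (hr : 0 ≤ r) :
    coverNum F r ≤ diamCoverNum F r := by
  classical
  refine le_iInf fun U => le_iInf fun hU => le_iInf fun hd => ?_
  have hc : ∀ A : Set X, ∃ c : X, A ∈ U → A ⊆ closedBall c r := by
    intro A
    rcases A.eq_empty_or_nonempty with rfl | ⟨c, hc⟩
    · exact ⟨Classical.arbitrary X, fun _ => empty_subset _⟩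
    · refine ⟨c, fun hA x hx => ?_⟩
      have h := (edist_le_ediam_of_mem hx hc).trans (hd A hA)
      rwa [edist_le_ofReal hr] at h
  choose c hc using hc
  refine (iInf₂_le (U.image c) ?_).trans (by exact_mod_cast Finset.card_image_le)
  intro x hx
  obtain ⟨A, hA, hxA⟩ := hU hx
  simp only [Finset.mem_image, mem_iUnion]
  exact ⟨c A, ⟨A, hA, rfl⟩, hc A hA hxA⟩

theorem diamCoverNum_le_coverNum_half (F : Set X) {r : ℝ} (hr : 0 ≤ r) :
    diamCoverNum F r ≤ coverNum F (1 / 2 * r) := by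
  classical
  refine le_iInf fun s => le_iInf fun hs => ?_
  refine (diamCoverNum_le_card (s.image (closedBall · (1 / 2 * r))) ?_ ?_).trans
    (by exact_mod_cast Finset.card_image_le)
  · intro x hx
    obtain ⟨c, hc, hxc⟩ := mem_iUnion₂.1 (hs hx)
    exact ⟨closedBall c (1 / 2 * r), by simpa using ⟨c, hc, rfl⟩, hxc⟩
  · intro A hA
    obtain ⟨c, -, rfl⟩ := Finset.mem_image.1 hA
    refine ediam_le fun x hx y hy => ?_
    rw [edist_le_ofReal hr]
    have := dist_triangle_right x y c
    rw [mem_closedBall] at hx hy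
    linarith

end Covers

section Cantor

/-- The left endpoint of the level `n` interval with address `ε`. -/
noncomputable def cantorLeft (lam : ℕ → ℝ) (ε : ℕ → Bool) (n : ℕ) : ℝ :=
  ∑ i ∈ Finset.range n, if ε i then cantorLen lam i - cantorLen lam (i + 1) else 0

/-- The level `n` interval with address `ε`. -/
def cantorInterval (lam : ℕ → ℝ) (ε : ℕ → Bool) (n : ℕ) : Set ℝ :=
  Icc (cantorLeft lam ε n) (cantorLeft lam ε n + cantorLen lam n)

variable {lam : ℕ → ℝ}

theorem mem_cantorSet_iff {x : ℝ} :
    x ∈ cantorSet lam ↔ ∀ n, ∃ ε, x ∈ cantorInterval lam ε n := by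
  simp only [cantorSet, cantorPre, mem_iInter, mem_iUnion]
  rfl

theorem cantorLeft_succ (ε : ℕ → Bool) (n : ℕ) :
    cantorLeft lam ε (n + 1) =
      cantorLeft lam ε n + if ε n then cantorLen lam n - cantorLen lam (n + 1) else 0 :=
  Finset.sum_range_succ _ n

theorem cantorLeft_congr {ε η : ℕ → Bool} {n : ℕ} (h : ∀ i < n, ε i = η i) :
    cantorLeft lam ε n = cantorLeft lam η n :=
  Finset.sum_congr rfl fun i hi => by rw [h i (Finset.mem_range.1 hi)]

theorem cantorLen_succ (n : ℕ) : cantorLen lam (n + 1) = cantorLen lam n * lam n :=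
  Finset.prod_range_succ _ n

theorem cantorLen_pos (hlam : ∀ i, lam i ∈ Ioo (0 : ℝ) (1 / 2)) (n : ℕ) : 0 < cantorLen lam n :=
  Finset.prod_pos fun i _ => (hlam i).1

theorem two_mul_cantorLen_succ_lt (hlam : ∀ i, lam i ∈ Ioo (0 : ℝ) (1 / 2)) (n : ℕ) :
    2 * cantorLen lam (n + 1) < cantorLen lam n := by
  rw [cantorLen_succ]
  nlinarith [cantorLen_pos hlam n, (hlam n).2]

theorem cantorLen_le_half_pow (hlam : ∀ i, lam i ∈ Ioo (0 : ℝ) (1 / 2)) (n : ℕ) :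
    cantorLen lam n ≤ (1 / 2) ^ n := by
  refine (Finset.prod_le_prod (fun i _ => (hlam i).1.le) fun i _ => (hlam i).2.le).trans_eq ?_
  simp

theorem exists_cantorLen_le (hlam : ∀ i, lam i ∈ Ioo (0 : ℝ) (1 / 2)) {δ : ℝ} (hδ : 0 < δ) :
    ∃ n, cantorLen lam n ≤ δ := by
  obtain ⟨n, hn⟩ := exists_pow_lt_of_lt_one hδ (by norm_num : (1 / 2 : ℝ) < 1)
  exact ⟨n, (cantorLen_le_half_pow hlam n).trans hn.le⟩

theorem cantorInterval_antitone (hlam : ∀ i, lam i ∈ Ioo (0 : ℝ) (1 / 2)) (ε : ℕ → Bool) :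
    Antitone (cantorInterval lam ε) := by
  refine antitone_nat_of_succ_le fun n => ?_
  have h1 := two_mul_cantorLen_succ_lt hlam n
  have h2 := cantorLen_pos hlam (n + 1)
  apply Icc_subset_Icc <;> rw [cantorLeft_succ] <;> split_ifs <;> linarith

/-- Distinct left endpoints of level `n` are more than the level `n` length apart. -/
theorem cantorLeft_trichotomy (hlam : ∀ i, lam i ∈ Ioo (0 : ℝ) (1 / 2)) (ε η : ℕ → Bool) (n : ℕ) :
    cantorLeft lam ε n = cantorLeft lam η n ∨
      cantorLeft lam ε n + cantorLen lam n < cantorLeft lam η n ∨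
      cantorLeft lam η n + cantorLen lam n < cantorLeft lam ε n := by
  induction n with
  | zero => exact Or.inl (by simp [cantorLeft])
  | succ n ih =>
    have h1 := two_mul_cantorLen_succ_lt hlam n
    have h2 := cantorLen_pos hlam (n + 1)
    simp only [cantorLeft_succ]
    rcases ih with h | h | h
    · cases ε n <;> cases η n <;> simp [h]
      · exact Or.inr (Or.inl (by linarith))
      · exact Or.inr (Or.inr (by linarith))
    · refine Or.inr (Or.inl ?_)
      split_ifs <;> linarith
    · refine Or.inr (Or.inr ?_)
      split_ifs <;> linarith

theorem cantorLeft_eq_of_mem (hlam : ∀ i, lam i ∈ Ioo (0 : ℝ) (1 / 2)) {ε η : ℕ → Bool} {n : ℕ}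
    {x : ℝ} (hε : x ∈ cantorInterval lam ε n) (hη : x ∈ cantorInterval lam η n) :
    cantorLeft lam ε n = cantorLeft lam η n := by
  obtain ⟨a, b⟩ := hε
  obtain ⟨c, d⟩ := hη
  rcases cantorLeft_trichotomy hlam ε η n with h | h | h <;> linarith

theorem cantorInterval_congr {ε η : ℕ → Bool} {n : ℕ}
    (h : cantorLeft lam ε n = cantorLeft lam η n) :
    cantorInterval lam ε n = cantorInterval lam η n := by
  rw [cantorInterval, cantorInterval, h]

theorem cantorLeft_splice (ε η : ℕ → Bool) {n m : ℕ} (h : n ≤ m) :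
    cantorLeft lam (fun i => if i < n then ε i else η i) m =
      cantorLeft lam ε n + (cantorLeft lam η m - cantorLeft lam η n) := by
  induction m, h using Nat.le_induction with
  | base =>
    rw [cantorLeft_congr (η := ε) fun i hi => if_pos hi]
    ring
  | succ m hm ih =>
    rw [cantorLeft_succ, ih, cantorLeft_succ, if_neg hm.not_gt]
    ring

theorem add_mem_cantorSet (hlam : ∀ i, lam i ∈ Ioo (0 : ℝ) (1 / 2)) {ε η : ℕ → Bool} {n : ℕ}
    {x : ℝ} (hx : x ∈ cantorSet lam) (hxε : x ∈ cantorInterval lam ε n) :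
    x + (cantorLeft lam η n - cantorLeft lam ε n) ∈ cantorSet lam ∩ cantorInterval lam η n := by
  have hmem : x + (cantorLeft lam η n - cantorLeft lam ε n) ∈ cantorInterval lam η n :=
    ⟨by linarith [hxε.1], by linarith [hxε.2]⟩
  refine ⟨mem_cantorSet_iff.2 fun m => ?_, hmem⟩
  rcases le_total m n with hmn | hnm
  · exact ⟨η, cantorInterval_antitone hlam η hmn hmem⟩
  · obtain ⟨θ, hθ⟩ := mem_cantorSet_iff.1 hx m
    have h := cantorLeft_eq_of_mem hlam hxε (cantorInterval_antitone hlam θ hnm hθ)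
    refine ⟨fun i => if i < n then η i else θ i, ?_⟩
    rw [cantorInterval, cantorLeft_splice η θ hnm]
    exact ⟨by linarith [hθ.1], by linarith [hθ.2]⟩

theorem diamCoverNum_cantorInterval_le (hlam : ∀ i, lam i ∈ Ioo (0 : ℝ) (1 / 2))
    (ε η : ℕ → Bool) (n : ℕ) (ρ : ℝ) :
    diamCoverNum (cantorSet lam ∩ cantorInterval lam ε n) ρ ≤
      diamCoverNum (cantorSet lam ∩ cantorInterval lam η n) ρ := by
  refine (diamCoverNum_mono ?_ ρ).trans
    ((isometry_add_right (cantorLeft lam ε n - cantorLeft lam η n)).diamCoverNum_image_le _ ρ)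
  intro x hx
  exact ⟨_, add_mem_cantorSet hlam (η := η) hx.1 hx.2, by ring⟩

theorem diamCoverNum_cantorInterval_le_two_mul (hlam : ∀ i, lam i ∈ Ioo (0 : ℝ) (1 / 2))
    (ε η : ℕ → Bool) (n : ℕ) (ρ : ℝ) :
    diamCoverNum (cantorSet lam ∩ cantorInterval lam ε n) ρ ≤
      2 * diamCoverNum (cantorSet lam ∩ cantorInterval lam η (n + 1)) ρ := by
  have hsub : cantorSet lam ∩ cantorInterval lam ε n ⊆
      cantorSet lam ∩ cantorInterval lam (Function.update ε n false) (n + 1) ∪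
        cantorSet lam ∩ cantorInterval lam (Function.update ε n true) (n + 1) := by
    rw [← inter_union_distrib_left]
    rintro x ⟨hx, hxε⟩
    refine ⟨hx, ?_⟩
    obtain ⟨θ, hθ⟩ := mem_cantorSet_iff.1 hx (n + 1)
    have h := cantorLeft_eq_of_mem hlam hxε (cantorInterval_antitone hlam θ n.le_succ hθ)
    have key : ∀ b, θ n = b →
        x ∈ cantorInterval lam (Function.update ε n b) (n + 1) := by
      rintro b rfl
      rwa [cantorInterval_congr (η := θ)]
      rw [cantorLeft_succ, cantorLeft_succ, ← h, Function.update_self,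
        cantorLeft_congr (η := ε) fun i hi => Function.update_of_ne hi.ne _ _]
    cases hb : θ n
    · exact Or.inl (key _ hb)
    · exact Or.inr (key _ hb)
  refine (diamCoverNum_mono hsub ρ).trans ((diamCoverNum_union_le _ _ ρ).trans ?_)
  rw [two_mul]
  gcongr <;> exact diamCoverNum_cantorInterval_le hlam _ _ _ _

/-- A ball of radius less than the level `n` length meets at most three level `n` intervals. -/
theorem exists_closedBall_inter_cantorSet_subset (hlam : ∀ i, lam i ∈ Ioo (0 : ℝ) (1 / 2))
    {x δ : ℝ} {n : ℕ} (hx : x ∈ cantorSet lam) (hδ : δ < cantorLen lam n) :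
    ∃ ε η θ : ℕ → Bool, closedBall x δ ∩ cantorSet lam ⊆
      cantorSet lam ∩ cantorInterval lam ε n ∪ cantorSet lam ∩ cantorInterval lam η n ∪
        cantorSet lam ∩ cantorInterval lam θ n := by
  obtain ⟨ε, hε⟩ := mem_cantorSet_iff.1 hx n
  have hleft : ∃ η, ∀ y ∈ closedBall x δ ∩ cantorSet lam, y < cantorLeft lam ε n →
      y ∈ cantorInterval lam η n := by
    by_cases h : ∃ z ∈ closedBall x δ ∩ cantorSet lam, z < cantorLeft lam ε n
    · obtain ⟨z, ⟨hzx, hz⟩, hzε⟩ := h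
      obtain ⟨η, hη⟩ := mem_cantorSet_iff.1 hz n
      refine ⟨η, fun y ⟨hyx, hy⟩ hyε => ?_⟩
      obtain ⟨θ, hθ⟩ := mem_cantorSet_iff.1 hy n
      rw [Real.closedBall_eq_Icc] at hzx hyx
      have := hε.1; have := hε.2; have := hη.1; have := hη.2; have := hθ.1; have := hθ.2
      have := hzx.1; have := hyx.1
      rcases cantorLeft_trichotomy hlam η θ n with h | h | h
      · rwa [cantorInterval_congr h]
      · rcases cantorLeft_trichotomy hlam θ ε n with h' | h' | h' <;> linarith
      · rcases cantorLeft_trichotomy hlam η ε n with h' | h' | h' <;> linarith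
    · exact ⟨ε, fun y hy hyε => absurd ⟨y, hy, hyε⟩ h⟩
  have hright : ∃ η, ∀ y ∈ closedBall x δ ∩ cantorSet lam,
      cantorLeft lam ε n + cantorLen lam n < y → y ∈ cantorInterval lam η n := by
    by_cases h : ∃ z ∈ closedBall x δ ∩ cantorSet lam, cantorLeft lam ε n + cantorLen lam n < z
    · obtain ⟨z, ⟨hzx, hz⟩, hzε⟩ := h
      obtain ⟨η, hη⟩ := mem_cantorSet_iff.1 hz n
      refine ⟨η, fun y ⟨hyx, hy⟩ hyε => ?_⟩
      obtain ⟨θ, hθ⟩ := mem_cantorSet_iff.1 hy n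
      rw [Real.closedBall_eq_Icc] at hzx hyx
      have := hε.1; have := hε.2; have := hη.1; have := hη.2; have := hθ.1; have := hθ.2
      have := hzx.2; have := hyx.2
      rcases cantorLeft_trichotomy hlam η θ n with h | h | h
      · rwa [cantorInterval_congr h]
      · rcases cantorLeft_trichotomy hlam η ε n with h' | h' | h' <;> linarith
      · rcases cantorLeft_trichotomy hlam θ ε n with h' | h' | h' <;> linarith
    · exact ⟨ε, fun y hy hyε => absurd ⟨y, hy, hyε⟩ h⟩
  obtain ⟨η, hη⟩ := hleft
  obtain ⟨θ, hθ⟩ := hright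
  refine ⟨η, ε, θ, fun y hy => ?_⟩
  rcases lt_or_ge y (cantorLeft lam ε n) with h | h
  · exact Or.inl (Or.inl ⟨hy.2, hη y hy h⟩)
  rcases lt_or_ge (cantorLeft lam ε n + cantorLen lam n) y with h' | h'
  · exact Or.inr ⟨hy.2, hθ y hy h'⟩
  · exact Or.inl (Or.inr ⟨hy.2, h, h'⟩)

theorem cantorInterval_subset_closedBall {ε : ℕ → Bool} {n : ℕ} {x δ : ℝ}
    (hx : x ∈ cantorInterval lam ε n) (hδ : cantorLen lam n ≤ δ) :
    cantorInterval lam ε n ⊆ closedBall x δ := by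
  intro y hy
  rw [Real.closedBall_eq_Icc]
  exact ⟨by linarith [hx.2, hy.1], by linarith [hx.1, hy.2]⟩

theorem diamCoverNum_closedBall_inter_cantorSet_le (hlam : ∀ i, lam i ∈ Ioo (0 : ℝ) (1 / 2))
    {x y δ : ℝ} (ρ : ℝ) (hx : x ∈ cantorSet lam) (hy : y ∈ cantorSet lam) (hδ : 0 < δ) :
    diamCoverNum (closedBall x δ ∩ cantorSet lam) ρ ≤
      6 * diamCoverNum (closedBall y δ ∩ cantorSet lam) ρ := by
  classical
  have hex := exists_cantorLen_le hlam hδ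
  obtain ⟨n, hn, hmin⟩ : ∃ n, cantorLen lam n ≤ δ ∧ ∀ m < n, δ < cantorLen lam m :=
    ⟨Nat.find hex, Nat.find_spec hex, fun m hm => not_le.1 (Nat.find_min hex hm)⟩
  obtain ⟨ζ, hζ⟩ := mem_cantorSet_iff.1 hy n
  have hlow : diamCoverNum (cantorSet lam ∩ cantorInterval lam ζ n) ρ ≤
      diamCoverNum (closedBall y δ ∩ cantorSet lam) ρ :=
    diamCoverNum_mono (subset_inter
      (inter_subset_right.trans (cantorInterval_subset_closedBall hζ hn)) inter_subset_left) ρ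
  refine le_trans ?_ (mul_le_mul_right hlow 6)
  cases n with
  | zero =>
    have h : closedBall x δ ∩ cantorSet lam ⊆ cantorSet lam ∩ cantorInterval lam ζ 0 := by
      rintro z ⟨-, hz⟩
      obtain ⟨θ, hθ⟩ := mem_cantorSet_iff.1 hz 0
      exact ⟨hz, by rwa [cantorInterval_congr (η := θ) (by simp [cantorLeft])]⟩
    exact (diamCoverNum_mono h ρ).trans (le_mul_of_one_le_left zero_le (by norm_num))
  | succ n =>
    obtain ⟨ε, η, θ, h⟩ :=
      exists_closedBall_inter_cantorSet_subset hlam hx (hmin n n.lt_succ_self)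
    have htwo ε := diamCoverNum_cantorInterval_le_two_mul hlam ε ζ n ρ
    calc
      _ ≤ _ := diamCoverNum_mono h ρ
      _ ≤ _ := diamCoverNum_union_le _ _ ρ
      _ ≤ _ := add_le_add_left (diamCoverNum_union_le _ _ ρ) _
      _ ≤ _ := add_le_add (add_le_add (htwo ε) (htwo η)) (htwo θ)
      _ = _ := by ring

end Cantor

theorem statement10 (lam : ℕ → ℝ) (hlam : ∀ i, lam i ∈ Set.Ioo (0 : ℝ) (1 / 2)) :
    EquiHomogeneous (cantorSet lam) ∧
      ∀ δ ρ : ℝ, 0 < ρ → ρ < δ →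
        (⨆ x ∈ cantorSet lam, diamCoverNum (closedBall x δ ∩ cantorSet lam) ρ) ≤
          6 * ⨅ x ∈ cantorSet lam, diamCoverNum (closedBall x δ ∩ cantorSet lam) ρ := by
  have key : ∀ δ ρ : ℝ, 0 < ρ → ρ < δ →
      (⨆ x ∈ cantorSet lam, diamCoverNum (closedBall x δ ∩ cantorSet lam) ρ) ≤
        6 * ⨅ x ∈ cantorSet lam, diamCoverNum (closedBall x δ ∩ cantorSet lam) ρ := by
    intro δ ρ hρ hρδ
    refine iSup₂_le fun x hx => ?_
    simp only [ENNReal.mul_iInf_of_ne (by norm_num : (6 : ℝ≥0∞) ≠ 0) (by norm_num)]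
    exact le_iInf₂ fun y hy =>
      diamCoverNum_closedBall_inter_cantorSet_le hlam ρ hx hy (hρ.trans hρδ)
  refine ⟨fun δ₀ _ => ⟨6, by norm_num, 1, 1 / 2, one_pos, by norm_num, fun δ ρ hρ hρδ _ => ?_⟩,
    key⟩
  calc
    _ ≤ _ := iSup₂_mono fun x _ => coverNum_le_diamCoverNum _ hρ.le
    _ ≤ _ := key δ ρ hρ hρδ
    _ ≤ _ := by
      rw [one_mul]
      push_cast
      gcongr
      exact diamCoverNum_le_coverNum_half _ hρ.le

end Paper
end
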